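/- Let F be a non-abelian free group. (i) If d ∈ F is such that the equation [x,y]d = 1 has a solution in F, then the radical R({[x,y]d}) in F ∗ F(x,y) equals the normal closure of [x,y]d. (ii) The radical R({[x₁,y₁][x₂,y₂]}) in F ∗ F(x₁,y₁,x₂,y₂) equals the normal closure of [x₁,y₁][x₂,y₂]. -/

import Mathlib

open Monoid

section EquationsOverGroups

variable {F : Type*} [Group F] {V : Type*}

/-- The commutator `[x,y] = x⁻¹y⁻¹xy`. -/
def pcomm {M : Type*} [Group M] (x y : M) : M := x⁻¹ * y⁻¹ * x * y

/-- Substitution of a tuple `a : V → F` for the variables: the homomorphism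
`F[X] = F ∗ F(X) →* F` which is the identity on `F` and sends the variable `x` to `a x`. -/
noncomputable def substHom (a : V → F) : Coprod F (FreeGroup V) →* F :=
  Coprod.lift (MonoidHom.id F) (FreeGroup.lift a)

/-- The algebraic set `V_F(S)` defined by a system of equations `S ⊆ F[X]`. -/
noncomputable def algSet (S : Set (Coprod F (FreeGroup V))) : Set (V → F) :=
  {a | ∀ w ∈ S, substHom a w = 1}

/-- The radical `R(S)` of a system of equations: all `T ∈ F[X]` vanishing on every
solution of `S = 1`. -/
noncomputable def radical (S : Set (Coprod F (FreeGroup V))) :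
    Subgroup (Coprod F (FreeGroup V)) where
  carrier := {T | ∀ a ∈ algSet S, substHom a T = 1}
  one_mem' := fun _ _ => map_one _
  mul_mem' := by
    intro x y hx hy a ha
    simp [map_mul, hx a ha, hy a ha]
  inv_mem' := by
    intro x hx a ha
    simp [map_inv, hx a ha]

end EquationsOverGroups

/-- The equation `[x,y]d = 1` in two variables over `F`. -/
noncomputable def eqnCommD (F : Type*) [Group F] (d : F) :
    Coprod F (FreeGroup (Fin 2)) :=
  pcomm (Coprod.inr (FreeGroup.of 0)) (Coprod.inr (FreeGroup.of 1)) * Coprod.inl d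

/-- The equation `[x₁,y₁][x₂,y₂] = 1` in four variables over `F`. -/
noncomputable def eqnCommComm (F : Type*) [Group F] :
    Coprod F (FreeGroup (Fin 4)) :=
  pcomm (Coprod.inr (FreeGroup.of 0)) (Coprod.inr (FreeGroup.of 1)) *
    pcomm (Coprod.inr (FreeGroup.of 2)) (Coprod.inr (FreeGroup.of 3))

open Polynomial in
/-- The polynomial matrix `diag(X²,1)` or `diag(1,X²)`. -/
noncomputable def Dm (R : Type*) [CommRing R] (s : Fin 2) : Matrix (Fin 2) (Fin 2) (Polynomial R) :=
  Matrix.diagonal (fun j => if j = s then X ^ 2 else 1)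

open Polynomial in
/-- Product of the letters `A D B` as a polynomial matrix. -/
noncomputable def Qval {R I : Type*} [CommRing R] (s : I → Fin 2)
    (A B : I → Matrix (Fin 2) (Fin 2) R) (l : List I) : Matrix (Fin 2) (Fin 2) (Polynomial R) :=
  (l.map fun i => (A i).map C * Dm R (s i) * (B i).map C).prod

open Polynomial in
lemma deg_comb {R : Type*} [CommRing R] [IsDomain R] (N : Matrix (Fin 2) (Fin 2) R)
    (w : Matrix (Fin 2) (Fin 2) R[X]) (s j k : Fin 2) (n : ℕ)
    (h1 : (w s j).degree = n) (h2 : ∀ k, k ≠ s → (w k j).degree < n) :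
    ((N.map C * w) k j).degree ≤ n ∧
      (N k s ≠ 0 → ((N.map C * w) k j).degree = n) := by
  have hC : ∀ (a : R) (p : R[X]), (C a * p).degree ≤ p.degree := by
    intro a p
    by_cases ha : a = 0
    · simp [ha]
    · rw [degree_C_mul ha]
  rw [Matrix.mul_apply]
  have key : ∀ t, t ≠ s → (∑ i, (N.map C) k i * w i j) = C (N k s) * w s j + C (N k t) * w t j := by
    intro t ht
    fin_cases s <;> fin_cases t <;> simp_all [Fin.sum_univ_two]
    ring
  obtain ⟨t, ht⟩ : ∃ t : Fin 2, t ≠ s := exists_ne s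
  rw [key t ht]
  have hb : (C (N k t) * w t j).degree < n := lt_of_le_of_lt (hC _ _) (h2 t ht)
  constructor
  · refine (degree_add_le _ _).trans (max_le ((hC _ _).trans h1.le) hb.le)
  · intro hN
    have : (C (N k s) * w s j).degree = n := by rw [degree_C_mul hN, h1]
    rw [degree_add_eq_left_of_degree_lt (by rw [this]; exact hb), this]

open Polynomial in
lemma deg_Dm {R : Type*} [CommRing R] [IsDomain R]
    (w : Matrix (Fin 2) (Fin 2) R[X]) (s j : Fin 2) (n : ℕ)
    (h1 : (w s j).degree = n) (h2 : ∀ k, (w k j).degree ≤ n) :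
    ((Dm R s * w) s j).degree = (n + 2 : ℕ) ∧ ∀ k, k ≠ s → ((Dm R s * w) k j).degree < (n + 2 : ℕ) := by
  unfold Dm
  refine ⟨?_, ?_⟩
  · rw [Matrix.diagonal_mul, if_pos rfl, degree_mul, h1, degree_X_pow]
    push_cast
    rw [add_comm]
  · intro k hk
    rw [Matrix.diagonal_mul, if_neg hk, one_mul]
    refine lt_of_le_of_lt (h2 k) ?_
    exact_mod_cast (by omega : n < n + 2)

open Polynomial in
lemma deg_main {R I : Type*} [CommRing R] [IsDomain R] (s : I → Fin 2)
    (A B : I → Matrix (Fin 2) (Fin 2) R) (hB : ∀ i, (B i).det ≠ 0) (l : List I) :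
    ∀ i, List.IsChain (fun i i' => (B i * A i') (s i) (s i') ≠ 0) (i :: l) →
    ∃ j, ((Dm R (s i) * ((B i).map C * Qval s A B l)) (s i) j).degree = (2 * (l.length + 1) : ℕ) ∧
      ∀ k, k ≠ s i →
        ((Dm R (s i) * ((B i).map C * Qval s A B l)) k j).degree < (2 * (l.length + 1) : ℕ) := by
  induction l with
  | nil =>
    intro i _
    have : ∃ j, B i (s i) j ≠ 0 := by
      by_contra! h
      exact hB i (Matrix.det_eq_zero_of_row_eq_zero (s i) h)
    obtain ⟨j, hj⟩ := this
    refine ⟨j, ?_⟩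
    have := deg_Dm ((B i).map C) (s i) j 0 (by simp [degree_C hj])
      (fun k => by simpa using degree_C_le)
    simpa [Qval] using this
  | cons i' l ih =>
    intro i hc
    rw [List.isChain_cons_cons] at hc
    obtain ⟨j, h1, h2⟩ := ih i' hc.2
    refine ⟨j, ?_⟩
    have e : (B i).map C * Qval s A B (i' :: l) =
        (B i * A i').map C * (Dm R (s i') * ((B i').map C * Qval s A B l)) := by
      simp only [Qval, List.map_cons, List.prod_cons, Matrix.map_mul, Matrix.mul_assoc]
    rw [e]
    have := deg_Dm _ (s i) j _ ((deg_comb (B i * A i') _ (s i') j (s i) _ h1 h2).2 hc.1)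
      (fun k => (deg_comb (B i * A i') _ (s i') j k _ h1 h2).1)
    simpa [mul_add, add_assoc] using this

open Polynomial in
lemma deg_Qval {R I : Type*} [CommRing R] [IsDomain R] (s : I → Fin 2)
    (A B : I → Matrix (Fin 2) (Fin 2) R) (hA : ∀ i, (A i).det ≠ 0)
    (hB : ∀ i, (B i).det ≠ 0) (l : List I) (hl : l ≠ [])
    (hc : List.IsChain (fun i i' => (B i * A i') (s i) (s i') ≠ 0) l) :
    ∃ k j, (Qval s A B l k j).degree = (2 * l.length : ℕ) := by
  cases l with
  | nil => exact absurd rfl hl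
  | cons i l =>
    obtain ⟨j, h1, h2⟩ := deg_main s A B hB l i hc
    have : ∃ k, A i k (s i) ≠ 0 := by
      by_contra! h
      exact hA i (Matrix.det_eq_zero_of_column_eq_zero (s i) h)
    obtain ⟨k, hk⟩ := this
    refine ⟨k, j, ?_⟩
    have := (deg_comb (A i) _ (s i) j k _ h1 h2).2 hk
    rw [List.length_cons, ← this]
    simp only [Qval, List.map_cons, List.prod_cons, Matrix.mul_assoc]

/-- Evaluating `Qval`. -/
lemma eval_Qval {R I K : Type*} [CommRing R] [CommRing K] (s : I → Fin 2)
    (A B : I → Matrix (Fin 2) (Fin 2) R) (φ : Polynomial R →+* K) (t : I → Matrix (Fin 2) (Fin 2) K)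
    (τ : K) (ht : ∀ i, ((A i).map Polynomial.C * Dm R (s i) * (B i).map Polynomial.C).map φ = τ • t i)
    (l : List I) : (Qval s A B l).map φ = τ ^ l.length • (l.map t).prod := by
  induction l with
  | nil => simp [Qval]
  | cons i l ih =>
    have : Qval s A B (i :: l) =
      ((A i).map Polynomial.C * Dm R (s i) * (B i).map Polynomial.C) * Qval s A B l := by
      simp [Qval]
    rw [this, Matrix.map_mul, ht, ih]
    simp [pow_succ, smul_smul, mul_comm]

/-- A faithful unimodular representation by 2x2 matrices. -/
structure GoodRep {F K : Type*} [Group F] [Field K] (ρ : F →* Matrix (Fin 2) (Fin 2) K) : Prop where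
  inj : Function.Injective ρ
  det : ∀ g, (ρ g).det = 1

section reps
variable {F K : Type*} [Group F] [IsMulTorsionFree F] [Field K] [CharP K 2]

lemma GoodRep.trace_zero {ρ : F →* Matrix (Fin 2) (Fin 2) K} (h : GoodRep ρ) (g : F)
    (hg : ρ g 0 0 + ρ g 1 1 = 0) : g = 1 := by
  have hd := h.det g
  rw [Matrix.det_fin_two] at hd
  have h2 : (2 : K) = 0 := by exact_mod_cast CharP.cast_eq_zero K 2
  have : ρ (g ^ 2) = ρ 1 := by
    rw [pow_two, map_mul, map_one]
    ext i j
    fin_cases i <;> fin_cases j <;> simp [Matrix.mul_apply, Fin.sum_univ_two]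
    · linear_combination ρ g 0 0 * hg - hd - h2
    · linear_combination ρ g 0 1 * hg
    · linear_combination ρ g 1 0 * hg
    · linear_combination ρ g 1 1 * hg - hd - h2
  have := h.inj this
  exact (pow_eq_one_iff_left (two_ne_zero)).1 this

lemma GoodRep.inv_entries {ρ : F →* Matrix (Fin 2) (Fin 2) K} (h : GoodRep ρ) (g : F) :
    ρ g⁻¹ = !![ρ g 1 1, - ρ g 0 1; - ρ g 1 0, ρ g 0 0] := by
  have hd := h.det g
  rw [← Matrix.adjugate_fin_two]
  have h1 : ρ g * ρ g⁻¹ = 1 := by rw [← map_mul]; simp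
  have h2 : (ρ g).adjugate * ρ g = 1 := by rw [Matrix.adjugate_mul, hd, one_smul]
  calc ρ g⁻¹ = ((ρ g).adjugate * ρ g) * ρ g⁻¹ := by rw [h2, one_mul]
    _ = _ := by rw [mul_assoc, h1, mul_one]

lemma GoodRep.upper_commute {ρ : F →* Matrix (Fin 2) (Fin 2) K} (hr : GoodRep ρ) (g h : F)
    (hg : ρ g 1 0 = 0) (hh : ρ h 1 0 = 0) : Commute g h := by
  have h2 : (2 : K) = 0 := by exact_mod_cast CharP.cast_eq_zero K 2
  have := hr.trace_zero (g * h * g⁻¹ * h⁻¹) (by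
    have d1 := hr.det g
    have d2 := hr.det h
    rw [Matrix.det_fin_two, hg] at d1
    rw [Matrix.det_fin_two, hh] at d2
    simp only [map_mul, hr.inv_entries]
    simp [Matrix.mul_apply, Fin.sum_univ_two, hg, hh]
    linear_combination 2 * (ρ h 0 0 * ρ h 1 1) * d1 + 2 * d2 + h2)
  rw [mul_inv_eq_one, mul_inv_eq_iff_eq_mul] at this
  exact this

lemma GoodRep.lower_commute {ρ : F →* Matrix (Fin 2) (Fin 2) K} (hr : GoodRep ρ) (g h : F)
    (hg : ρ g 0 1 = 0) (hh : ρ h 0 1 = 0) : Commute g h := by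
  have h2 : (2 : K) = 0 := by exact_mod_cast CharP.cast_eq_zero K 2
  have := hr.trace_zero (g * h * g⁻¹ * h⁻¹) (by
    have d1 := hr.det g
    have d2 := hr.det h
    rw [Matrix.det_fin_two, hg] at d1
    rw [Matrix.det_fin_two, hh] at d2
    simp only [map_mul, hr.inv_entries]
    simp [Matrix.mul_apply, Fin.sum_univ_two, hg, hh]
    linear_combination 2 * (ρ h 0 0 * ρ h 1 1) * d1 + 2 * d2 + h2)
  rw [mul_inv_eq_one, mul_inv_eq_iff_eq_mul] at this
  exact this

lemma commute_entries {ρ : F →* Matrix (Fin 2) (Fin 2) K} {b : F}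
    {x y : K} (hb : ρ b = Matrix.diagonal ![x, y]) (hxy : x ≠ y) (g : F) (hc : Commute g b) :
    ρ g 0 1 = 0 ∧ ρ g 1 0 = 0 := by
  have h : ρ g * ρ b = ρ b * ρ g := by rw [← map_mul, hc.eq, map_mul]
  rw [hb] at h
  have h01 := congrFun (congrFun h 0) 1
  have h10 := congrFun (congrFun h 1) 0
  simp [Matrix.mul_diagonal, Matrix.diagonal_mul] at h01 h10
  have hs : x - y ≠ 0 := sub_ne_zero.2 hxy
  constructor
  · refine (mul_eq_zero.1 (?_ : (x - y) * ρ g 0 1 = 0)).resolve_left hs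
    linear_combination -h01
  · refine (mul_eq_zero.1 (?_ : (x - y) * ρ g 1 0 = 0)).resolve_left hs
    linear_combination h10

lemma GoodRep.entries_ne {ρ : F →* Matrix (Fin 2) (Fin 2) K} (hr : GoodRep ρ) {b : F}
    {x y : K} (hb : ρ b = Matrix.diagonal ![x, y]) (g : F) (hc : ¬ Commute g b) :
    ρ g 0 1 ≠ 0 ∧ ρ g 1 0 ≠ 0 :=
  ⟨fun h => hc (hr.lower_commute g b h (by simp [hb])),
    fun h => hc (hr.upper_commute g b h (by simp [hb]))⟩

lemma GoodRep.entry00_ne {ρ : F →* Matrix (Fin 2) (Fin 2) K} (hr : GoodRep ρ) {b : F}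
    {x y : K} (hb : ρ b = Matrix.diagonal ![x, y]) (hxy : x ≠ y) (g : F) : ρ g 0 0 ≠ 0 := by
  intro h0
  have hd := hr.det g
  rw [Matrix.det_fin_two, h0] at hd
  have hs : x - y ≠ 0 := sub_ne_zero.2 hxy
  have e : Commute (g * b * g⁻¹) b := hr.lower_commute _ _ (by
    simp only [map_mul, hr.inv_entries, hb]
    simp [Matrix.mul_apply, Fin.sum_univ_two, h0, Matrix.diagonal]) (by simp [hb])
  have h10 := (commute_entries hb hxy _ e).2
  simp only [map_mul, hr.inv_entries, hb] at h10
  simp [Matrix.mul_apply, Fin.sum_univ_two, h0, Matrix.diagonal] at h10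
  have hg10 : ρ g 1 0 ≠ 0 := by
    intro h; rw [h] at hd; simp at hd
  have h11 : ρ g 1 1 = 0 := by
    have : (ρ g 1 0 * (x - y)) * ρ g 1 1 = 0 := by linear_combination h10
    exact (mul_eq_zero.1 this).resolve_left (mul_ne_zero hg10 hs)
  have := hr.trace_zero g (by rw [h0, h11, add_zero])
  rw [this] at h0
  simp at h0

lemma GoodRep.entry11_ne {ρ : F →* Matrix (Fin 2) (Fin 2) K} (hr : GoodRep ρ) {b : F}
    {x y : K} (hb : ρ b = Matrix.diagonal ![x, y]) (hxy : x ≠ y) (g : F) : ρ g 1 1 ≠ 0 := by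
  have := hr.entry00_ne hb hxy g⁻¹
  rwa [hr.inv_entries] at this

lemma exists_conj [IsAlgClosed K] (M : Matrix (Fin 2) (Fin 2) K) (hd : M.det = 1)
    (ht : M 0 0 + M 1 1 ≠ 0) : ∃ (P : Matrix (Fin 2) (Fin 2) K) (x : K),
      P.det ≠ 0 ∧ x ≠ 0 ∧ x ≠ x⁻¹ ∧ M * P = P * Matrix.diagonal ![x, x⁻¹] := by
  have h2 : (2 : K) = 0 := by exact_mod_cast CharP.cast_eq_zero K 2
  rw [Matrix.det_fin_two] at hd
  obtain ⟨x, hx⟩ : ∃ x : K, x ^ 2 - (M 0 0 + M 1 1) * x + 1 = 0 := by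
    have hdeg : (Polynomial.C (1:K) * Polynomial.X ^ 2 +
      Polynomial.C (- (M 0 0 + M 1 1)) * Polynomial.X + Polynomial.C 1).degree = 2 :=
      Polynomial.degree_quadratic one_ne_zero
    obtain ⟨x, hx⟩ := IsAlgClosed.exists_root _ (by rw [hdeg]; exact two_ne_zero)
    refine ⟨x, ?_⟩
    simp [Polynomial.IsRoot] at hx
    linear_combination hx
  have hx0 : x ≠ 0 := by rintro rfl; simp at hx
  have hi : x * x⁻¹ = 1 := mul_inv_cancel₀ hx0
  set y := x⁻¹ with hy
  have hsum : x + y = M 0 0 + M 1 1 := by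
    apply mul_left_cancel₀ hx0
    linear_combination hx + hi
  have hxy : x ≠ y := by
    intro h
    apply ht
    rw [← hsum, ← h]
    linear_combination x * h2
  have hyx : y - x ≠ 0 := sub_ne_zero.2 hxy.symm
  by_cases hq : M 0 1 = 0
  · by_cases hr : M 1 0 = 0
    · have : (x - M 0 0) * (x - M 1 1) = 0 := by
        rw [hq, hr] at hd
        linear_combination hx + hd
      rcases mul_eq_zero.1 this with h | h
      · refine ⟨1, x, by simp, hx0, hxy, ?_⟩
        rw [mul_one, one_mul]
        ext i j
        fin_cases i <;> fin_cases j <;> simp [hq, hr, ← hy]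
        · linear_combination -h
        · linear_combination h - hsum
      · refine ⟨!![0, 1; 1, 0], x, by simp, hx0, hxy, ?_⟩
        ext i j
        fin_cases i <;> fin_cases j <;>
          simp [hq, hr, ← hy, Matrix.mul_apply, Fin.sum_univ_two, Matrix.diagonal]
        · linear_combination h - hsum
        · linear_combination -h
    · refine ⟨!![x - M 1 1, y - M 1 1; M 1 0, M 1 0], x, ?_, hx0, hxy, ?_⟩
      · rw [Matrix.det_fin_two_of]
        intro h
        apply mul_ne_zero hr hyx
        linear_combination -h
      · ext i j
        fin_cases i <;> fin_cases j <;>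
          simp [← hy, Matrix.mul_apply, Fin.sum_univ_two, Matrix.diagonal]
        · linear_combination -hx - hd
        · linear_combination (-y) * hsum + hi - hd
        · ring
        · ring
  · refine ⟨!![M 0 1, M 0 1; x - M 0 0, y - M 0 0], x, ?_, hx0, hxy, ?_⟩
    · rw [Matrix.det_fin_two_of]
      intro h
      apply mul_ne_zero hq hyx
      linear_combination h
    · ext i j
      fin_cases i <;> fin_cases j <;>
        simp [← hy, Matrix.mul_apply, Fin.sum_univ_two, Matrix.diagonal]
      · ring
      · ring
      · linear_combination -hx - hd
      · linear_combination (-y) * hsum + hi - hd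

lemma GoodRep.exists_diag [IsAlgClosed K] {ρ : F →* Matrix (Fin 2) (Fin 2) K} (hr : GoodRep ρ)
    (b : F) (hb : b ≠ 1) : ∃ (ρ' : F →* Matrix (Fin 2) (Fin 2) K) (x : K), GoodRep ρ' ∧
      x ≠ 0 ∧ x ≠ x⁻¹ ∧ ρ' b = Matrix.diagonal ![x, x⁻¹] := by
  obtain ⟨P, x, hP, hx0, hx, e⟩ := exists_conj (ρ b) (hr.det b) (fun h => hb (hr.trace_zero b h))
  have hu : IsUnit P.det := isUnit_iff_ne_zero.2 hP
  have h1 : P⁻¹ * P = 1 := Matrix.nonsing_inv_mul _ hu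
  have h2 : P * P⁻¹ = 1 := Matrix.mul_nonsing_inv _ hu
  refine ⟨⟨⟨fun g => P⁻¹ * ρ g * P, by simp [h1]⟩, ?_⟩, x, ⟨?_, ?_⟩, hx0, hx, ?_⟩
  · intro g h
    show P⁻¹ * ρ (g * h) * P = (P⁻¹ * ρ g * P) * (P⁻¹ * ρ h * P)
    calc P⁻¹ * ρ (g * h) * P = P⁻¹ * ρ g * 1 * ρ h * P := by rw [map_mul]; noncomm_ring
      _ = _ := by rw [← h2]; noncomm_ring
  · intro g h hgh
    apply hr.inj
    have hgh : P⁻¹ * ρ g * P = P⁻¹ * ρ h * P := hgh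
    calc ρ g = (P * P⁻¹) * ρ g * (P * P⁻¹) := by rw [h2]; simp
      _ = P * (P⁻¹ * ρ g * P) * P⁻¹ := by noncomm_ring
      _ = (P * P⁻¹) * ρ h * (P * P⁻¹) := by rw [hgh]; noncomm_ring
      _ = ρ h := by rw [h2]; simp
  · intro g
    show (P⁻¹ * ρ g * P).det = 1
    rw [Matrix.det_mul, Matrix.det_mul, hr.det, mul_one, ← Matrix.det_mul, h1, Matrix.det_one]
  · show P⁻¹ * ρ b * P = _
    rw [mul_assoc, e, ← mul_assoc, h1, one_mul]

lemma GoodRep.comm_trans [IsAlgClosed K] {ρ : F →* Matrix (Fin 2) (Fin 2) K} (hr : GoodRep ρ)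
    {s u v : F} (hs : s ≠ 1) (hu : Commute u s) (hv : Commute v s) : Commute u v := by
  obtain ⟨ρ', x, h, hx0, hx, e⟩ := hr.exists_diag s hs
  exact h.lower_commute u v (commute_entries e hx u hu).1 (commute_entries e hx v hv).1

end reps

/-- `g` or `g⁻¹` according to a sign. -/
def sg {G : Type*} [Group G] (s : Bool) (g : G) : G := if s then g else g⁻¹

/-- index of the dominating entry for a sign. -/
def ix (s : Bool) : Fin 2 := if s then 0 else 1

lemma map_Dm {R K : Type*} [CommRing R] [CommRing K] (φ : Polynomial R →+* K)
    (A B : Matrix (Fin 2) (Fin 2) R) (s : Fin 2) :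
    (A.map Polynomial.C * Dm R s * B.map Polynomial.C).map φ =
      A.map (φ.comp Polynomial.C) *
        Matrix.diagonal (fun j => if j = s then (φ Polynomial.X) ^ 2 else 1) *
          B.map (φ.comp Polynomial.C) := by
  rw [Matrix.map_mul, Matrix.map_mul, Matrix.map_map, Matrix.map_map, Dm, Matrix.diagonal_map (map_zero φ)]
  congr 3
  ext j
  split_ifs <;> simp_all

lemma diag_smul {K : Type*} [Field K] (s : Bool) (τ : K) (hτ : τ ≠ 0) :
    (Matrix.diagonal (fun j => if j = ix s then τ ^ 2 else 1) : Matrix (Fin 2) (Fin 2) K) =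
      τ • Matrix.diagonal (if s then ![τ, τ⁻¹] else ![τ⁻¹, τ]) := by
  ext i j
  cases s <;> fin_cases i <;> fin_cases j <;> simp [ix, hτ, pow_two]

lemma GoodRep.big_powers {F K : Type*} [Group F] [IsMulTorsionFree F] [Field K] [CharP K 2]
    [IsAlgClosed K] {ρ₀ : F →* Matrix (Fin 2) (Fin 2) K} (hr₀ : GoodRep ρ₀) {b : F} (hb : b ≠ 1)
    (l : List (Bool × F × F)) (hl : l ≠ [])
    (hc : l.IsChain (fun x y => x.1 ≠ y.1 → ¬ Commute (x.2.2 * y.2.1) b)) (g : F) :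
    {n : ℕ | (l.map fun x => x.2.1 * sg x.1 (b ^ n) * x.2.2).prod = g}.Finite := by
  classical
  obtain ⟨ρ, x, hr, hx0, hx, e⟩ := hr₀.exists_diag b hb
  have hpow : ∀ n : ℕ, ρ (b ^ n) = Matrix.diagonal ![x ^ n, (x ^ n)⁻¹] := by
    intro n
    rw [map_pow, e, Matrix.diagonal_pow]
    congr 1
    ext i
    fin_cases i <;> simp
  have hinv : ∀ n : ℕ, ρ (b ^ n)⁻¹ = Matrix.diagonal ![(x ^ n)⁻¹, x ^ n] := by
    intro n
    rw [hr.inv_entries, hpow]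
    ext i j
    fin_cases i <;> fin_cases j <;> simp
  have hinj : Function.Injective (fun n : ℕ => x ^ n) := by
    have h1 : Function.Injective (fun n : ℕ => b ^ n) := by
      intro m n hmn
      have hmn : b ^ m = b ^ n := hmn
      have h3 : b ^ ((m : ℤ) - n) = 1 := by rw [zpow_sub, zpow_natCast, zpow_natCast, hmn, mul_inv_cancel]
      have := (IsMulTorsionFree.zpow_eq_one_iff_right hb).1 h3
      omega
    intro m n hmn
    apply h1
    apply hr.inj
    simp only at hmn ⊢
    rw [hpow, hpow, hmn]
  let s : (Bool × F × F) → Fin 2 := fun x => ix x.1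
  let A : (Bool × F × F) → Matrix (Fin 2) (Fin 2) K := fun x => ρ x.2.1
  let B : (Bool × F × F) → Matrix (Fin 2) (Fin 2) K := fun x => ρ x.2.2
  have hch : l.IsChain (fun i i' => (B i * A i') (s i) (s i') ≠ 0) := by
    refine hc.imp ?_
    rintro ⟨s1, p, q⟩ ⟨s2, p', q'⟩ h
    simp only [A, B, s, ← map_mul] at h ⊢
    cases s1 <;> cases s2
    · exact hr.entry11_ne e hx _
    · exact (hr.entries_ne e _ (h (by simp))).2
    · exact (hr.entries_ne e _ (h (by simp))).1
    · exact hr.entry00_ne e hx _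
  obtain ⟨k, j, hkj⟩ := deg_Qval s A B (fun i => by simp [A, hr.det]) (fun i => by simp [B, hr.det])
    l hl hch
  have hlen : 0 < l.length := List.length_pos_iff.2 hl
  let p : Polynomial K := Qval s A B l k j - Polynomial.C (ρ g k j) * Polynomial.X ^ l.length
  have hp : p ≠ 0 := by
    intro h
    rw [sub_eq_zero] at h
    have h3 := Polynomial.degree_C_mul_X_pow_le l.length (ρ g k j)
    rw [← h, hkj] at h3
    have : 2 * l.length ≤ l.length := by exact_mod_cast h3
    omega
  refine Set.Finite.of_finite_image (f := fun n : ℕ => x ^ n) ?_ hinj.injOn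
  refine (p.roots.toFinset.finite_toSet).subset ?_
  rintro _ ⟨n, hn, rfl⟩
  simp only [Set.mem_setOf_eq] at hn
  simp only [Finset.mem_coe, Multiset.mem_toFinset, Polynomial.mem_roots hp, Polynomial.IsRoot]
  have hxn : x ^ n ≠ 0 := pow_ne_zero _ hx0
  have ev := eval_Qval s A B (Polynomial.evalRingHom (x ^ n))
    (fun y => ρ (y.2.1 * sg y.1 (b ^ n) * y.2.2)) (x ^ n) (by
      rintro ⟨s1, q, r⟩
      rw [map_Dm]
      have hid : (Polynomial.evalRingHom (x ^ n)).comp Polynomial.C = RingHom.id K := by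
        ext; simp
      simp only [hid, s, A, B]
      have hid2 : ∀ M : Matrix (Fin 2) (Fin 2) K, M.map (RingHom.id K) = M := fun M => by ext; simp
      rw [hid2, hid2, Polynomial.coe_evalRingHom, Polynomial.eval_X, diag_smul s1 _ hxn]
      simp only [map_mul, Matrix.mul_smul, Matrix.smul_mul]
      congr 3
      cases s1 <;> simp [sg, hpow, hinv]) l
  have ev2 : (l.map (fun y => ρ (y.2.1 * sg y.1 (b ^ n) * y.2.2))).prod = ρ g := by
    rw [← hn, map_list_prod, List.map_map]
    rfl
  rw [ev2] at ev
  have := congrFun (congrFun ev k) j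
  simp only [Matrix.map_apply, Polynomial.coe_evalRingHom, Matrix.smul_apply, smul_eq_mul] at this
  simp only [p, Polynomial.eval_sub, this, Polynomial.eval_mul, Polynomial.eval_C, Polynomial.eval_pow,
    Polynomial.eval_X]
  ring

/-- Conjugating matrix. -/
noncomputable def Pm (α : Type*) (i : α) : Matrix (Fin 2) (Fin 2) (MvPolynomial α (ZMod 2)) :=
  !![1, 1; MvPolynomial.X i, MvPolynomial.X i + 1]
/-- Its inverse. -/
noncomputable def Pi' (α : Type*) (i : α) : Matrix (Fin 2) (Fin 2) (MvPolynomial α (ZMod 2)) :=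
  !![MvPolynomial.X i + 1, -1; -MvPolynomial.X i, 1]

lemma Pi_Pm (α : Type*) (i : α) : Pi' α i * Pm α i = 1 := by
  ext1 j k
  fin_cases j <;> fin_cases k <;> simp [Pi', Pm, Matrix.mul_apply, Fin.sum_univ_two]

lemma Pm_Pi (α : Type*) (i : α) : Pm α i * Pi' α i = 1 := by
  ext1 j k
  fin_cases j <;> fin_cases k <;> simp [Pi', Pm, Matrix.mul_apply, Fin.sum_univ_two] <;> ring

lemma Pi_Pm_ne (α : Type*) (i j : α) (hij : i ≠ j) (r s : Fin 2) : (Pi' α i * Pm α j) r s ≠ 0 := by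
  have h1 : (MvPolynomial.X i : MvPolynomial α (ZMod 2)) - MvPolynomial.X j ≠ 0 := by
    rw [sub_ne_zero]
    exact fun h => hij (MvPolynomial.X_injective h)
  have h2 : ∀ i j : α, i ≠ j → (MvPolynomial.X i : MvPolynomial α (ZMod 2)) + 1 - MvPolynomial.X j ≠ 0 := by
    intro i j _ h
    have := congrArg (MvPolynomial.eval (fun _ => (0 : ZMod 2))) h
    simp at this
  have e : Pi' α i * Pm α j = !![MvPolynomial.X i + 1 - MvPolynomial.X j, MvPolynomial.X i - MvPolynomial.X j;
      -(MvPolynomial.X i - MvPolynomial.X j), MvPolynomial.X j + 1 - MvPolynomial.X i] := by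
    ext1 r s
    fin_cases r <;> fin_cases s <;> simp [Pi', Pm, Matrix.mul_apply, Fin.sum_univ_two] <;> ring
  rw [e]
  fin_cases r <;> fin_cases s
  · exact h2 i j hij
  · exact h1
  · exact neg_ne_zero.2 h1
  · exact h2 j i hij.symm

lemma exists_goodRep.{u} (α : Type u) : ∃ (K : Type u) (_ : Field K) (_ : IsAlgClosed K) (_ : CharP K 2)
    (ρ : FreeGroup α →* Matrix (Fin 2) (Fin 2) K), GoodRep ρ := by
  classical
  let R := MvPolynomial α (ZMod 2)
  let K := AlgebraicClosure (FractionRing (Polynomial R))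
  let φ : Polynomial R →+* K := (algebraMap (FractionRing (Polynomial R)) K).comp
    (algebraMap (Polynomial R) (FractionRing (Polynomial R)))
  have hφ : Function.Injective φ := (algebraMap (FractionRing (Polynomial R)) K).injective.comp
    (IsFractionRing.injective (Polynomial R) (FractionRing (Polynomial R)))
  have hchar : CharP K 2 := by
    have : CharP (Polynomial R) 2 := inferInstance
    exact charP_of_injective_ringHom hφ 2
  let ψ : R →+* K := φ.comp Polynomial.C
  let τ : K := φ Polynomial.X
  have hτ : τ ≠ 0 := by
    intro h
    exact Polynomial.X_ne_zero (hφ (h.trans (map_zero φ).symm))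
  let S : Bool → Matrix (Fin 2) (Fin 2) K := fun s => Matrix.diagonal (if s then ![τ, τ⁻¹] else ![τ⁻¹, τ])
  have hSdet : ∀ s, (S s).det = 1 := by
    intro s
    cases s <;> simp [S, Matrix.det_fin_two, hτ]
  have hSS : S true * S false = 1 := by
    ext i j
    fin_cases i <;> fin_cases j <;> simp [S, hτ]
  let t : α × Bool → Matrix (Fin 2) (Fin 2) K := fun c => (Pm α c.1).map ψ * S c.2 * (Pi' α c.1).map ψ
  have hPP : ∀ i, (Pm α i).map ψ * (Pi' α i).map ψ = 1 := by
    intro i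
    rw [← Matrix.map_mul, Pm_Pi]
    simp
  have hPP' : ∀ i, (Pi' α i).map ψ * (Pm α i).map ψ = 1 := by
    intro i
    rw [← Matrix.map_mul, Pi_Pm]
    simp
  have htdet : ∀ c, (t c).det = 1 := by
    intro c
    simp only [t, Matrix.det_mul, hSdet, mul_one]
    rw [← Matrix.det_mul, hPP, Matrix.det_one]
  have htt : ∀ i, t (i, true) * t (i, false) = 1 := by
    intro i
    calc t (i, true) * t (i, false) = (Pm α i).map ψ * S true * ((Pi' α i).map ψ * (Pm α i).map ψ) *
        S false * (Pi' α i).map ψ := by simp only [t]; noncomm_ring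
      _ = (Pm α i).map ψ * (S true * S false) * (Pi' α i).map ψ := by rw [hPP']; noncomm_ring
      _ = 1 := by rw [hSS, mul_one, hPP]
  have htt' : ∀ i, t (i, false) * t (i, true) = 1 := fun i => mul_eq_one_comm.1 (htt i)
  let U : α → (Matrix (Fin 2) (Fin 2) K)ˣ := fun i => ⟨t (i, true), t (i, false), htt i, htt' i⟩
  let f : FreeGroup α →* (Matrix (Fin 2) (Fin 2) K)ˣ := FreeGroup.lift U
  have hfl : ∀ l : List (α × Bool), ((f (FreeGroup.mk l) : (Matrix (Fin 2) (Fin 2) K)ˣ) :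
      Matrix (Fin 2) (Fin 2) K) = (l.map t).prod := by
    intro l
    simp only [f, FreeGroup.lift_mk]
    induction l with
    | nil => simp
    | cons c l ih =>
      obtain ⟨i, s⟩ := c
      rw [List.map_cons, List.prod_cons, Units.val_mul, ih, List.map_cons,
        List.prod_cons]
      cases s <;> rfl
  have hfdet : ∀ g, ((f g : (Matrix (Fin 2) (Fin 2) K)ˣ) : Matrix (Fin 2) (Fin 2) K).det = 1 := by
    intro g
    rw [← FreeGroup.mk_toWord (x := g), hfl]
    induction g.toWord with
    | nil => simp
    | cons c l ih => rw [List.map_cons, List.prod_cons, Matrix.det_mul, ih, htdet, one_mul]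
  refine ⟨K, inferInstance, inferInstance, hchar, (Units.coeHom _).comp f, ?_, hfdet⟩
  rw [injective_iff_map_eq_one]
  intro g hg
  have hg : ((f g : (Matrix (Fin 2) (Fin 2) K)ˣ) : Matrix (Fin 2) (Fin 2) K) = 1 := hg
  by_contra hne
  have hl : g.toWord ≠ [] := fun h => hne (FreeGroup.toWord_eq_nil_iff.1 h)
  rw [← FreeGroup.mk_toWord (x := g), hfl] at hg
  have hred : g.toWord.IsChain (fun a b => a.1 = b.1 → a.2 = b.2) := FreeGroup.isReduced_toWord
  set l := g.toWord with hldef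
  let s : α × Bool → Fin 2 := fun c => ix c.2
  let A : α × Bool → Matrix (Fin 2) (Fin 2) R := fun c => Pm α c.1
  let B : α × Bool → Matrix (Fin 2) (Fin 2) R := fun c => Pi' α c.1
  have hdet : ∀ i, (Pm α i).det = 1 ∧ (Pi' α i).det = 1 := by
    intro i
    constructor <;> simp [Pm, Pi', Matrix.det_fin_two_of]
  obtain ⟨k, j, hkj⟩ := deg_Qval s A B (fun i => by simp [A, (hdet _).1])
    (fun i => by simp [B, (hdet _).2]) l hl (by
      refine hred.imp ?_
      rintro ⟨i, s1⟩ ⟨i', s2⟩ h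
      simp only [A, B, s] at h ⊢
      by_cases hi : i = i'
      · subst hi
        rw [h rfl, Pi_Pm]
        simp
      · exact Pi_Pm_ne α i i' hi _ _)
  have ev := eval_Qval s A B φ t τ (by
    rintro ⟨i, s1⟩
    rw [map_Dm, show φ Polynomial.X = τ from rfl]
    simp only [s, A, B, t, S]
    rw [diag_smul s1 τ hτ]
    simp only [Matrix.mul_smul, Matrix.smul_mul]
    rfl) l
  rw [hg] at ev
  have h1 := congrFun (congrFun ev k) j
  have h2 : φ (Qval s A B l k j) = φ (Polynomial.C ((1 : Matrix (Fin 2) (Fin 2) R) k j) * Polynomial.X ^ l.length) := by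
    have h1 : φ (Qval s A B l k j) = τ ^ l.length * ((1 : Matrix (Fin 2) (Fin 2) K) k j) := h1
    rw [h1, map_mul, map_pow, mul_comm]
    congr 1
    by_cases h : k = j <;> simp [Matrix.one_apply, h]
  have h3 := Polynomial.degree_C_mul_X_pow_le l.length ((1 : Matrix (Fin 2) (Fin 2) R) k j)
  rw [← hφ h2, hkj] at h3
  have h4 : 2 * l.length ≤ l.length := by exact_mod_cast h3
  have hlen : 0 < l.length := List.length_pos_iff.2 hl
  omega

section freefacts
variable {F : Type} [Group F] [IsFreeGroup F]

lemma free_torsionFree (F : Type) [Group F] [IsFreeGroup F] : IsMulTorsionFree F :=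
  Function.Injective.isMulTorsionFree (IsFreeGroup.toFreeGroup F).toMonoidHom
    (IsFreeGroup.toFreeGroup F).injective

lemma free_goodRep (F : Type) [Group F] [IsFreeGroup F] :
    ∃ (K : Type) (_ : Field K) (_ : IsAlgClosed K) (_ : CharP K 2)
    (ρ : F →* Matrix (Fin 2) (Fin 2) K), GoodRep ρ := by
  obtain ⟨K, h1, h2, h3, ρ, h⟩ := exists_goodRep (IsFreeGroup.Generators F)
  exact ⟨K, h1, h2, h3, ρ.comp (IsFreeGroup.toFreeGroup F).toMonoidHom,
    h.inj.comp (IsFreeGroup.toFreeGroup F).injective, fun g => h.det _⟩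

lemma free_comm_trans {s u v : F} (hs : s ≠ 1) (hu : Commute u s) (hv : Commute v s) :
    Commute u v := by
  have := free_torsionFree F
  obtain ⟨K, h1, h2, h3, ρ, h⟩ := free_goodRep F
  exact h.comm_trans hs hu hv

lemma free_big_powers {b : F} (hb : b ≠ 1)
    (l : List (Bool × F × F)) (hl : l ≠ [])
    (hc : l.IsChain (fun x y => x.1 ≠ y.1 → ¬ Commute (x.2.2 * y.2.1) b)) (g : F) :
    {n : ℕ | (l.map fun x => x.2.1 * sg x.1 (b ^ n) * x.2.2).prod = g}.Finite := by
  have := free_torsionFree F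
  obtain ⟨K, h1, h2, h3, ρ, h⟩ := free_goodRep F
  exact h.big_powers hb l hl hc g

lemma of_not_comm {ι : Type*} {i j : ι} (hij : i ≠ j) :
    ¬ Commute (FreeGroup.of i) (FreeGroup.of j) := by
  classical
  intro h
  have := h.map (FreeGroup.lift (fun k => if k = i then Equiv.swap (0 : Fin 3) 1 else Equiv.swap 1 2))
  simp only [FreeGroup.lift_apply_of, if_true, if_neg hij.symm] at this
  revert this
  unfold Commute SemiconjBy
  decide

lemma free_common_root {u c : F} (h : Commute u c) : ∃ v : F, ∃ m n : ℤ, u = v ^ m ∧ c = v ^ n := by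
  let N := Subgroup.closure ({u, c} : Set F)
  have hN : ∀ x y : N, x * y = y * x := by
    have : IsMulCommutative N := by
      apply Subgroup.isMulCommutative_closure
      rintro x (rfl | rfl) y (rfl | rfl)
      · rfl
      · exact h.eq
      · exact h.eq.symm
      · rfl
    exact fun x y => mul_comm' x y
  let e := IsFreeGroup.toFreeGroup N
  have hsub : Subsingleton (IsFreeGroup.Generators N) := by
    constructor
    intro i j
    by_contra hij
    apply of_not_comm hij
    have := hN (e.symm (FreeGroup.of i)) (e.symm (FreeGroup.of j))
    rw [← map_mul, ← map_mul] at this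
    exact e.symm.injective this
  have hcyc : ∃ w : FreeGroup (IsFreeGroup.Generators N), ∀ x, x ∈ Subgroup.zpowers w := by
    rcases isEmpty_or_nonempty (IsFreeGroup.Generators N) with hE | ⟨⟨i⟩⟩
    · exact ⟨1, fun x => by rw [Subsingleton.elim x 1]; exact Subgroup.one_mem _⟩
    · refine ⟨FreeGroup.of i, fun x => ?_⟩
      have h1 : x ∈ Subgroup.closure (Set.range (FreeGroup.of : IsFreeGroup.Generators N → _)) := by
        rw [FreeGroup.closure_range_of]; trivial
      refine (Subgroup.closure_le _).2 ?_ h1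
      rintro _ ⟨k, rfl⟩
      rw [Subsingleton.elim k i]
      exact Subgroup.mem_zpowers _
  obtain ⟨w, hw⟩ := hcyc
  have hu : u ∈ N := Subgroup.subset_closure (by simp)
  have hc : c ∈ N := Subgroup.subset_closure (by simp)
  have key : ∀ x (hx : x ∈ N), ∃ m : ℤ, x = (e.symm w : F) ^ m := by
    intro x hx
    obtain ⟨m, hm⟩ := hw (e ⟨x, hx⟩)
    refine ⟨m, ?_⟩
    have h2 : e.symm (w ^ m) = ⟨x, hx⟩ := by
      have hm : w ^ m = _ := hm
      rw [hm]; simp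
    rw [map_zpow] at h2
    have := congrArg (Subtype.val) h2
    simpa using this.symm
  obtain ⟨m, hm⟩ := key u hu
  obtain ⟨n, hn⟩ := key c hc
  exact ⟨_, m, n, hm, hn⟩

lemma free_centralizer {u c : F} (χ : F →* Multiplicative ℤ) (hχ : χ c = Multiplicative.ofAdd 1)
    (h : Commute u c) : ∃ k : ℤ, u = c ^ k := by
  obtain ⟨v, m, n, hu, hc⟩ := free_common_root h
  have h1 : n * (χ v).toAdd = 1 := by
    have := congrArg Multiplicative.toAdd hχ
    rw [hc, map_zpow] at this
    simpa using this
  rcases Int.isUnit_iff.1 (IsUnit.of_mul_eq_one _ h1) with rfl | rfl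
  · exact ⟨m, by rw [hu, hc]; simp⟩
  · exact ⟨-m, by rw [hu, hc]; simp⟩
end freefacts

open Monoid in
instance free_coprod {F : Type} [Group F] [IsFreeGroup F] : IsFreeGroup (Coprod F (FreeGroup Unit)) := by
  let e : FreeGroup (IsFreeGroup.Generators F ⊕ Unit) ≃* Coprod F (FreeGroup Unit) :=
    MonoidHom.toMulEquiv
      (FreeGroup.lift (Sum.elim (fun i => Coprod.inl (IsFreeGroup.of i)) (fun _ => Coprod.inr (FreeGroup.of ()))))
      (Coprod.lift (IsFreeGroup.lift (fun i => FreeGroup.of (Sum.inl i)))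
        (FreeGroup.lift (fun i => FreeGroup.of (Sum.inr i))))
      (by
        ext x
        rcases x with x | x <;> simp)
      (by
        apply Coprod.hom_ext
        · apply IsFreeGroup.ext_hom
          intro a
          simp
        · ext
          simp)
  exact IsFreeGroup.ofMulEquiv e

open Monoid

lemma sg_true {G : Type*} [Group G] (g : G) : sg true g = g := rfl
lemma sg_false {G : Type*} [Group G] (g : G) : sg false g = g⁻¹ := rfl
lemma map_sg {G H : Type*} [Group G] [Group H] (f : G →* H) (s : Bool) (g : G) :
    f (sg s g) = sg s (f g) := by
  cases s <;> simp [sg]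

lemma word_form {Q H : Type*} [Group Q] [Group H] (j : H →* Q) (y : Q)
    (hg : Subgroup.closure (Set.range j ∪ {y}) = ⊤) (T : Q) :
    ∃ (u0 : H) (l : List (Bool × H)), T = j u0 * (l.map fun x => sg x.1 y * j x.2).prod ∧
      l.IsChain (fun x x' => x.1 ≠ x'.1 → sg x.1 y * j x.2 * (sg x.1 y)⁻¹ ∉ j.range) := by
  have step : ∀ (s : Bool) (T : Q), (∃ (u0 : H) (l : List (Bool × H)),
      T = j u0 * (l.map fun x => sg x.1 y * j x.2).prod ∧
      l.IsChain (fun x x' => x.1 ≠ x'.1 → sg x.1 y * j x.2 * (sg x.1 y)⁻¹ ∉ j.range)) →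
      (∃ (u0 : H) (l : List (Bool × H)),
      sg s y * T = j u0 * (l.map fun x => sg x.1 y * j x.2).prod ∧
      l.IsChain (fun x x' => x.1 ≠ x'.1 → sg x.1 y * j x.2 * (sg x.1 y)⁻¹ ∉ j.range)) := by
    rintro s T ⟨u0, l, rfl, hl⟩
    rcases l with _ | ⟨⟨s', u1⟩, l⟩
    · exact ⟨1, [(s, u0)], by simp, by simp⟩
    by_cases hs : s ≠ s' ∧ sg s y * j u0 * (sg s y)⁻¹ ∈ j.range
    · obtain ⟨hs, h, hh⟩ := hs
      refine ⟨h * u1, l, ?_, hl.tail⟩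
      have e : sg s' y = (sg s y)⁻¹ := by
        cases s <;> cases s' <;> simp_all [sg]
      simp only [List.map_cons, List.prod_cons, map_mul, hh, e]
      group
    · refine ⟨1, (s, u0) :: (s', u1) :: l, by simp [mul_assoc], ?_⟩
      rw [List.isChain_cons_cons]
      exact ⟨fun h1 h2 => hs ⟨h1, h2⟩, hl⟩
  have hT : T ∈ Subgroup.closure (Set.range j ∪ {y}) := by rw [hg]; trivial
  have stepj : ∀ (h : H) (T : Q), (∃ (u0 : H) (l : List (Bool × H)),
      T = j u0 * (l.map fun x => sg x.1 y * j x.2).prod ∧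
      l.IsChain (fun x x' => x.1 ≠ x'.1 → sg x.1 y * j x.2 * (sg x.1 y)⁻¹ ∉ j.range)) →
      (∃ (u0 : H) (l : List (Bool × H)),
      j h * T = j u0 * (l.map fun x => sg x.1 y * j x.2).prod ∧
      l.IsChain (fun x x' => x.1 ≠ x'.1 → sg x.1 y * j x.2 * (sg x.1 y)⁻¹ ∉ j.range)) := by
    rintro h T ⟨u0, l, rfl, hl⟩
    exact ⟨h * u0, l, by simp [mul_assoc], hl⟩
  refine Subgroup.closure_induction_left (p := fun T _ => ∃ (u0 : H) (l : List (Bool × H)),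
      T = j u0 * (l.map fun x => sg x.1 y * j x.2).prod ∧
      l.IsChain (fun x x' => x.1 ≠ x'.1 → sg x.1 y * j x.2 * (sg x.1 y)⁻¹ ∉ j.range))
      ⟨1, [], by simp, by simp⟩ ?_ ?_ hT
  · rintro x (⟨h, rfl⟩ | hx) T _ ih
    · exact stepj h T ih
    · rw [Set.mem_singleton_iff] at hx
      subst hx
      exact step true T ih
  · rintro x (⟨h, rfl⟩ | hx) T _ ih
    · rw [← map_inv]; exact stepj h⁻¹ T ih
    · rw [Set.mem_singleton_iff] at hx
      subst hx
      exact step false T ih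

section mainarg
variable {F : Type} [Group F] [IsFreeGroup F]

lemma fin_bad {a b : F} (hb : b ≠ 1) (l : List (Bool × F)) (hl : l ≠ [])
    (hc : l.IsChain fun x y => x.1 ≠ y.1 →
      (x.1 = true → ¬ Commute (a * x.2 * a⁻¹) b) ∧ (x.1 = false → ¬ Commute x.2 b)) (g : F) :
    {n : ℕ | (l.map fun x => sg x.1 (b ^ n * a) * x.2).prod = g}.Finite := by
  have := free_big_powers hb
    (l.map fun x => (x.1, (if x.1 then 1 else a⁻¹), (if x.1 then a * x.2 else x.2)))
    (by simpa using hl) (by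
      rw [List.isChain_map]
      refine hc.imp ?_
      rintro ⟨s, u⟩ ⟨s', u'⟩ h hs
      cases s <;> cases s' <;> simp_all) g
  convert this using 5
  rw [List.map_map]
  refine List.map_congr_left ?_
  rintro ⟨s, u⟩ -
  cases s <;> simp [sg, mul_assoc]

lemma sepA1 {Q : Type*} [Group Q] (i : F →* Q) (z : Q)
    (hg : Subgroup.closure (Set.range i ∪ {z}) = ⊤) (T : Q) (hT : T ≠ 1) :
    ∃ S : Finset F, (∀ g ∈ S, g ≠ 1) ∧ ∀ a b : F, b ≠ 1 →
      (∀ g ∈ S, ¬ Commute g b ∧ ¬ Commute (a * g * a⁻¹) b) →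
      {m : ℕ | ∃ φ : Q →* F, (∀ g, φ (i g) = g) ∧ φ z = b ^ m * a ∧ φ T = 1}.Finite := by
  classical
  obtain ⟨u0, l, rfl, hl⟩ := word_form i z hg T
  refine ⟨(l.map Prod.snd).toFinset.filter (· ≠ 1), by simp, ?_⟩
  intro a b hb hS
  rcases eq_or_ne l [] with rfl | hl0
  · convert Set.finite_empty
    rw [Set.eq_empty_iff_forall_notMem]
    rintro m ⟨φ, h1, h2, h3⟩
    apply hT
    simp only [List.map_nil, List.prod_nil, mul_one, h1] at h3
    simp [h3]
  refine (fin_bad (a := a) hb l hl0 ?_ u0⁻¹).subset ?_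
  · refine List.IsChain.imp_of_mem_imp ?_ hl
    rintro ⟨s, u⟩ ⟨s', u'⟩ hx hy h hs
    have := hS u (by
      simp only [Finset.mem_filter, List.mem_toFinset, List.mem_map, Prod.exists]
      refine ⟨⟨s, u, hx, rfl⟩, ?_⟩
      rintro rfl
      exact h hs ⟨1, by simp⟩)
    exact ⟨fun _ => this.2, fun _ => this.1⟩
  · rintro m ⟨φ, h1, h2, h3⟩
    simp only [map_mul, h1, map_list_prod, List.map_map] at h3
    refine Eq.trans ?_ (eq_inv_of_mul_eq_one_right h3)
    congr 1
    refine List.map_congr_left ?_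
    rintro ⟨s, u⟩ -
    simp [map_sg, h2, h1]

lemma pcomm_pow_left {G : Type*} [Group G] (a b : G) (m : ℕ) :
    pcomm (b ^ m * a) b = pcomm a b := by
  have : Commute (b ^ m) b := (Commute.refl b).pow_left m
  have h : b⁻¹ * b ^ m = b ^ m * b⁻¹ := (this.symm.inv_left).eq
  unfold pcomm
  calc (b ^ m * a)⁻¹ * b⁻¹ * (b ^ m * a) * b = a⁻¹ * (b ^ m)⁻¹ * (b⁻¹ * b ^ m) * a * b := by group
    _ = _ := by rw [h]; group

lemma pcomm_pow_right {G : Type*} [Group G] (a b : G) (m : ℕ) :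
    pcomm a (a ^ m * b) = pcomm a b := by
  have : Commute (a ^ m) a := (Commute.refl a).pow_left m
  have h : a * a ^ m = a ^ m * a := this.symm.eq
  unfold pcomm
  calc a⁻¹ * (a ^ m * b)⁻¹ * a * (a ^ m * b) = a⁻¹ * b⁻¹ * (a ^ m)⁻¹ * (a * a ^ m) * b := by group
    _ = _ := by rw [h]; group

lemma bad_k {a b s : F} (hab : ¬ Commute a b) (hs : s ≠ 1) :
    {k : ℕ | Commute s (a ^ k * b)}.Finite := by
  have := free_torsionFree F
  apply Set.Subsingleton.finite
  -- two exponents give commuting elements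
  have key : ∀ k n : ℕ, Commute s (a ^ k * b) → Commute s (a ^ (k + (n + 1)) * b) → False := by
    intro k n h1 h2
    have h3 := free_comm_trans hs h1.symm h2.symm
    have h4 : Commute (a ^ (n + 1)) (a ^ k * b) := by
      have e : a ^ (n + 1) = (a ^ (k + (n + 1)) * b) * (a ^ k * b)⁻¹ := by
        rw [add_comm k, pow_add]; group
      rw [e]
      exact (h3.symm).mul_left ((Commute.refl _).inv_left)
    have ha : a ≠ 1 := by rintro rfl; exact hab (Commute.one_left _)
    have ha' : a ^ (n + 1) ≠ 1 := by
      intro h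
      exact ha (by simpa using h)
    have h5 : Commute a (a ^ k * b) :=
      free_comm_trans ha' ((Commute.refl a).pow_right _) h4.symm
    apply hab
    have h6 : Commute a ((a ^ k)⁻¹ * (a ^ k * b)) :=
      (((Commute.refl a).pow_right k).inv_right).mul_right h5
    simpa using h6
  intro k hk n hn
  rcases lt_trichotomy k n with h | h | h
  · obtain ⟨c, rfl⟩ := Nat.exists_eq_add_of_lt h
    exact (key k c hk hn).elim
  · exact h
  · obtain ⟨c, rfl⟩ := Nat.exists_eq_add_of_lt h
    exact (key n c hn hk).elim

lemma sepA2 {Q : Type*} [Group Q] (i : F →* Q) (z : Q)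
    (hg : Subgroup.closure (Set.range i ∪ {z}) = ⊤) (Ts : Set Q) (hfin : Ts.Finite)
    {a0 b0 : F} (hab : ¬ Commute a0 b0) :
    ∃ a b : F, pcomm a b = pcomm a0 b0 ∧ ∀ T ∈ Ts, T ≠ 1 →
      ∀ φ : Q →* F, (∀ g, φ (i g) = g) → φ z = a → φ T ≠ 1 := by
  classical
  have H : ∀ T : Q, ∃ S : Finset F, (∀ g ∈ S, g ≠ 1) ∧ (T ≠ 1 → ∀ a b : F, b ≠ 1 →
      (∀ g ∈ S, ¬ Commute g b ∧ ¬ Commute (a * g * a⁻¹) b) →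
      {m : ℕ | ∃ φ : Q →* F, (∀ g, φ (i g) = g) ∧ φ z = b ^ m * a ∧ φ T = 1}.Finite) := by
    intro T
    by_cases hT : T = 1
    · exact ⟨∅, by simp, fun h => (h hT).elim⟩
    · obtain ⟨S, h1, h2⟩ := sepA1 i z hg T hT
      exact ⟨S, h1, fun _ => h2⟩
  choose S hS1 hS2 using H
  have hbad : (⋃ T ∈ Ts, ⋃ g ∈ S T, ({k : ℕ | Commute g (a0 ^ k * b0)} ∪
      {k : ℕ | Commute (a0 * g * a0⁻¹) (a0 ^ k * b0)})).Finite := by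
    refine hfin.biUnion fun T _ => (S T).finite_toSet.biUnion fun g hgS => ?_
    have h1 := hS1 T g hgS
    exact (bad_k hab h1).union (bad_k hab (by simpa using h1))
  obtain ⟨k, hk⟩ := hbad.exists_notMem
  simp only [Set.mem_iUnion, not_exists, Set.mem_union, Set.mem_ofPred_eq, not_or] at hk
  have hb : a0 ^ k * b0 ≠ 1 := by
    intro h
    apply hab
    have h2 := eq_inv_of_mul_eq_one_right h
    rw [h2]
    exact ((Commute.refl a0).pow_right k).inv_right
  have hbad2 : (⋃ T ∈ {T | T ∈ Ts ∧ T ≠ 1}, {m : ℕ | ∃ φ : Q →* F, (∀ g, φ (i g) = g) ∧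
      φ z = (a0 ^ k * b0) ^ m * a0 ∧ φ T = 1}).Finite := by
    refine Set.Finite.biUnion (hfin.subset fun T hT => hT.1) fun T hT => ?_
    exact hS2 T hT.2 a0 _ hb (fun g hgS => hk T hT.1 g hgS)
  obtain ⟨m, hm⟩ := hbad2.exists_notMem
  simp only [Set.mem_iUnion, not_exists, Set.mem_ofPred_eq] at hm
  refine ⟨(a0 ^ k * b0) ^ m * a0, a0 ^ k * b0, by rw [pcomm_pow_left, pcomm_pow_right], ?_⟩
  intro T hT hT1 φ h1 h2 h3
  exact hm T ⟨hT, hT1⟩ φ ⟨h1, h2, h3⟩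

lemma pcomm_eq_one {G : Type*} [Group G] {a b : G} : pcomm a b = 1 ↔ Commute a b := by
  have e : a * b = b * a * pcomm a b := by unfold pcomm; group
  rw [Commute, SemiconjBy, e]
  simp

lemma sepA3 {Q : Type*} [Group Q] (i : F →* Q) (z : Q)
    (hg : Subgroup.closure (Set.range i ∪ {z}) = ⊤) (Ts : Set Q) (hfin : Ts.Finite)
    (hna : ∃ x y : F, ¬ Commute x y) (d : F) (hd : ∃ a b : F, pcomm a b * d = 1) :
    ∃ a b : F, pcomm a b * d = 1 ∧ ∀ T ∈ Ts, T ≠ 1 →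
      ∀ φ : Q →* F, (∀ g, φ (i g) = g) → φ z = a → φ T ≠ 1 := by
  obtain ⟨a0, b0, h⟩ := hd
  by_cases hab : Commute a0 b0
  · obtain ⟨x, y, hxy⟩ := hna
    obtain ⟨a, b, -, h2⟩ := sepA2 i z hg Ts hfin hxy
    rw [pcomm_eq_one.2 hab, one_mul] at h
    exact ⟨a, 1, by simp [h, pcomm], h2⟩
  · obtain ⟨a, b, h1, h2⟩ := sepA2 i z hg Ts hfin hab
    exact ⟨a, b, by rw [h1, h], h2⟩
end mainarg

open Monoid

lemma map_pcomm {G H : Type*} [Group G] [Group H] (f : G →* H) (a b : G) :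
    f (pcomm a b) = pcomm (f a) (f b) := by
  simp [pcomm]

lemma closure_coprod (F : Type*) [Group F] :
    Subgroup.closure (Set.range (Coprod.inl : F →* Coprod F (FreeGroup Unit)) ∪
      {Coprod.inr (FreeGroup.of ())}) = ⊤ := by
  rw [Subgroup.closure_union, eq_top_iff, ← Coprod.range_inl_sup_range_inr]
  refine sup_le_sup ?_ ?_
  · intro x hx
    exact Subgroup.subset_closure hx
  · rw [MonoidHom.range_eq_map, ← FreeGroup.closure_range_of, MonoidHom.map_closure]
    apply Subgroup.closure_mono
    rintro _ ⟨_, ⟨⟨⟩, rfl⟩, rfl⟩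
    simp

lemma conj_zpow_mem {Q H : Type*} [Group Q] [Group H] (j : H →* Q) (y : Q) (c c' : H)
    (h : y * j c * y⁻¹ = j c') (k : ℤ) : y * j (c ^ k) * y⁻¹ ∈ j.range := by
  refine ⟨c' ^ k, ?_⟩
  rw [map_zpow, map_zpow, ← h, conj_zpow]

set_option maxHeartbeats 400000 in
lemma mainI {F : Type} [Group F] [IsFreeGroup F] {Q : Type*} [Group Q] (i : F →* Q) (X Y : Q)
    (hg : Subgroup.closure (Set.range i ∪ {X, Y}) = ⊤) (hna : ∃ x y : F, ¬ Commute x y)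
    (d : F) (hd : ∃ a b : F, pcomm a b * d = 1) (hrel : pcomm X Y * i d = 1)
    (T : Q) (hT : T ≠ 1) :
    ∃ a b : F, pcomm a b * d = 1 ∧
      ∀ φ : Q →* F, (∀ g, φ (i g) = g) → φ X = a → φ Y = b → φ T ≠ 1 := by
  classical
  obtain ⟨j, hj⟩ : ∃ j : Coprod F (FreeGroup Unit) →* Q, j = Coprod.lift i (FreeGroup.lift fun _ => X) := ⟨_, rfl⟩
  obtain ⟨x, hx⟩ : ∃ x : Coprod F (FreeGroup Unit), x = Coprod.inr (FreeGroup.of ()) := ⟨_, rfl⟩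
  have hjx : j x = X := by simp [hj, hx]
  have hji : ∀ g, j (Coprod.inl g) = i g := by intro g; simp [hj]
  obtain ⟨c, hc⟩ : ∃ c : Coprod F (FreeGroup Unit), c = x * (Coprod.inl d)⁻¹ := ⟨_, rfl⟩
  have hjc : j c = X * (i d)⁻¹ := by simp only [hc, map_mul, map_inv, hjx, hji]
  have hg' : Subgroup.closure (Set.range j ∪ {Y}) = ⊤ := by
    rw [eq_top_iff, ← hg]
    apply Subgroup.closure_mono
    rintro _ (⟨g, rfl⟩ | rfl | hy)
    · exact Or.inl ⟨_, hji g⟩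
    · exact Or.inl ⟨_, hjx⟩
    · exact Or.inr hy
  obtain ⟨χ, hχ⟩ : ∃ χ : Coprod F (FreeGroup Unit) →* Multiplicative ℤ,
    χ = Coprod.lift 1 (FreeGroup.lift fun _ => Multiplicative.ofAdd 1) := ⟨_, rfl⟩
  have hχx : χ x = Multiplicative.ofAdd 1 := by simp [hχ, hx]
  have hχc : χ c = Multiplicative.ofAdd 1 := by
    simp only [hc, map_mul, hχx, map_inv]
    simp [hχ]
  have hx1 : x ≠ 1 := by
    intro h
    rw [h, map_one] at hχx
    exact zero_ne_one (α := ℤ) (congrArg Multiplicative.toAdd hχx)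
  have hYX : Y⁻¹ * j x * Y⁻¹⁻¹ = j c := by
    rw [hjx, hjc, eq_mul_inv_iff_mul_eq, ← mul_left_cancel_iff (a := X⁻¹)]
    simpa [pcomm, mul_assoc] using hrel
  have hYX' : Y * j c * Y⁻¹ = j x := by rw [← hYX]; group
  obtain ⟨u0, l, rfl, hl⟩ := word_form j Y hg' T
  let Ts : Set (Coprod F (FreeGroup Unit)) :=
    {x, u0} ∪ ((fun p => pcomm p.2 x) '' {p | p ∈ l} ∪ (fun p => pcomm p.2 c) '' {p | p ∈ l})
  have hfin : Ts.Finite := by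
    have : {p | p ∈ l}.Finite := l.finite_toSet
    exact (Set.toFinite _).union ((this.image _).union (this.image _))
  obtain ⟨a, b, hab, hsep⟩ := sepA3 (Coprod.inl) x (hx ▸ closure_coprod F) Ts hfin hna d hd
  obtain ⟨f, hf⟩ : ∃ f : Coprod F (FreeGroup Unit) →* F,
    f = Coprod.lift (MonoidHom.id F) (FreeGroup.lift fun _ => a) := ⟨_, rfl⟩
  have hfl : ∀ g, f (Coprod.inl g) = g := by intro g; simp [hf]
  have hfx : f x = a := by simp [hf, hx]
  have hsepf : ∀ T ∈ Ts, T ≠ 1 → f T ≠ 1 := fun T h1 h2 => hsep T h1 h2 f hfl hfx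
  have hfc : f c = a * d⁻¹ := by simp only [hc, map_mul, map_inv, hfx, hfl]
  have ha : a ≠ 1 := by
    rw [← hfx]; exact hsepf x (Or.inl (by simp)) hx1
  have hba : b * (a * d⁻¹) * b⁻¹ = a := by
    have e : d = (pcomm a b)⁻¹ := eq_inv_of_mul_eq_one_right hab
    rw [e]; unfold pcomm; group
  have hφ : ∀ φ : Q →* F, (∀ g, φ (i g) = g) → φ X = a → ∀ u, φ (j u) = f u := by
    intro φ h1 h2 u
    have : φ.comp j = f := by
      apply Coprod.hom_ext
      · ext g; simp [hji, h1, hfl]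
      · ext t
        simpa [hj, hf] using h2
    exact DFunLike.congr_fun this u
  rcases eq_or_ne l [] with rfl | hl0
  · refine ⟨a, b, hab, ?_⟩
    intro φ h1 h2 h3 h4
    simp only [List.map_nil, List.prod_nil, mul_one] at hT h4
    rw [hφ φ h1 h2] at h4
    refine hsepf u0 (Or.inl (by simp)) ?_ h4
    rintro rfl
    simp at hT
  have hbad := fin_bad (a := b) ha (l.map fun p => (p.1, f p.2)) (by simpa using hl0) (by
    rw [List.isChain_map]
    refine List.IsChain.imp_of_mem_imp ?_ hl
    rintro ⟨s, u⟩ ⟨s', u'⟩ hp hy h hs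
    have h := h hs
    dsimp only at h ⊢
    refine ⟨?_, ?_⟩
    · rintro rfl hcm
      rw [sg_true] at h
      have hcu : ¬ Commute u c := by
        intro h0
        obtain ⟨k, rfl⟩ := free_centralizer χ hχc h0
        exact h (conj_zpow_mem j Y c x hYX' k)
      have := hsepf (pcomm u c) (Or.inr (Or.inr ⟨_, hp, rfl⟩)) (fun h => hcu (pcomm_eq_one.1 h))
      rw [map_pcomm, Ne, pcomm_eq_one, hfc] at this
      apply this
      rw [← hba] at hcm
      exact (Commute.conj_iff b).1 hcm
    · rintro rfl hcm
      rw [sg_false] at h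
      have hcu : ¬ Commute u x := by
        intro h0
        obtain ⟨k, rfl⟩ := free_centralizer χ hχx h0
        exact h (conj_zpow_mem j Y⁻¹ x c hYX k)
      have := hsepf (pcomm u x) (Or.inr (Or.inl ⟨_, hp, rfl⟩)) (fun h => hcu (pcomm_eq_one.1 h))
      rw [map_pcomm, Ne, pcomm_eq_one, hfx] at this
      exact this hcm) (f u0)⁻¹
  obtain ⟨n, hn⟩ := hbad.exists_notMem
  refine ⟨a, a ^ n * b, by rw [pcomm_pow_right, hab], ?_⟩
  intro φ h1 h2 h3 h4
  apply hn
  rw [map_mul, hφ φ h1 h2, map_list_prod, List.map_map] at h4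
  refine Eq.trans ?_ (eq_inv_of_mul_eq_one_right h4)
  rw [List.map_map]
  congr 1
  refine List.map_congr_left ?_
  rintro ⟨s, u⟩ -
  simp [map_sg, h3, hφ φ h1 h2]

open Monoid

lemma sep_step {F : Type} [Group F] [IsFreeGroup F] (hna : ∃ x y : F, ¬ Commute x y)
    (T : Coprod F (FreeGroup Unit)) (hT : T ≠ 1) :
    ∃ g : Coprod F (FreeGroup Unit) →* F, (∀ u, g (Coprod.inl u) = u) ∧ g T ≠ 1 := by
  obtain ⟨x, y, hxy⟩ := hna
  obtain ⟨z, hz⟩ : ∃ z : Coprod F (FreeGroup Unit), z = Coprod.inr (FreeGroup.of ()) := ⟨_, rfl⟩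
  have hcl := closure_coprod F
  rw [← hz] at hcl
  obtain ⟨a, b, -, h⟩ := sepA2 (Q := Coprod F (FreeGroup Unit))
    (i := (Coprod.inl : F →* Coprod F (FreeGroup Unit))) z hcl {T} (Set.finite_singleton T) hxy
  obtain ⟨g, hg⟩ : ∃ g : Coprod F (FreeGroup Unit) →* F,
    g = Coprod.lift (MonoidHom.id F) (FreeGroup.lift fun _ => a) := ⟨_, rfl⟩
  have h1 : ∀ u, g (Coprod.inl u) = u := by intro u; simp [hg]
  have h2 : g z = a := by simp [hg, hz]
  exact ⟨g, h1, h T (Set.mem_singleton T) hT g h1 h2⟩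

lemma nonabelian_coprod {F : Type} [Group F] (hna : ∃ x y : F, ¬ Commute x y) :
    ∃ x y : Coprod F (FreeGroup Unit), ¬ Commute x y := by
  obtain ⟨x, y, hxy⟩ := hna
  refine ⟨Coprod.inl x, Coprod.inl y, fun h => hxy ?_⟩
  have := h.map (Coprod.fst : Coprod F (FreeGroup Unit) →* F)
  simpa using this

lemma closure_vars {F Q : Type*} {V : Type*} [Group F] [Group Q]
    (π : Coprod F (FreeGroup V) →* Q) (hπ : Function.Surjective π) (S : Set Q)
    (h1 : ∀ g, π (Coprod.inl g) ∈ Subgroup.closure S)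
    (h2 : ∀ v, π (Coprod.inr (FreeGroup.of v)) ∈ Subgroup.closure S) :
    Subgroup.closure S = ⊤ := by
  rw [eq_top_iff, ← MonoidHom.range_eq_top.2 hπ, MonoidHom.range_eq_map,
    ← Coprod.range_inl_sup_range_inr, Subgroup.map_le_iff_le_comap, sup_le_iff]
  constructor
  · rintro _ ⟨g, rfl⟩
    exact h1 g
  · rw [MonoidHom.range_eq_map, ← FreeGroup.closure_range_of, MonoidHom.map_closure,
      Subgroup.closure_le]
    rintro _ ⟨_, ⟨v, rfl⟩, rfl⟩
    exact h2 v

lemma ncl_le_radical {F V : Type*} [Group F] (S : Set (Coprod F (FreeGroup V))) :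
    Subgroup.normalClosure S ≤ radical S := by
  intro T hT a ha
  have : Subgroup.normalClosure S ≤ (substHom a).ker :=
    Subgroup.normalClosure_le_normal (fun w hw => ha w hw)
  exact this hT

lemma partI (α : Type) (hna : ∃ x y : FreeGroup α, ¬ Commute x y) (d : FreeGroup α)
    (hd : (algSet {eqnCommD (FreeGroup α) d}).Nonempty) :
    radical {eqnCommD (FreeGroup α) d} ≤ Subgroup.normalClosure {eqnCommD (FreeGroup α) d} := by
  intro T hT
  by_contra hTN
  obtain ⟨s, hs⟩ := hd
  have hs := hs _ rfl
  let π := QuotientGroup.mk' (Subgroup.normalClosure {eqnCommD (FreeGroup α) d})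
  have hπ : Function.Surjective π := QuotientGroup.mk'_surjective _
  have hT1 : π T ≠ 1 := by
    intro h
    exact hTN ((QuotientGroup.eq_one_iff _).1 h)
  have hrel : π (eqnCommD (FreeGroup α) d) = 1 :=
    (QuotientGroup.eq_one_iff _).2 (Subgroup.subset_normalClosure rfl)
  obtain ⟨a, b, hab, hsep⟩ := mainI (π.comp Coprod.inl) (π (Coprod.inr (FreeGroup.of 0)))
    (π (Coprod.inr (FreeGroup.of 1)))
    (closure_vars π hπ _ (fun g => Subgroup.subset_closure (Or.inl ⟨g, rfl⟩))
      (fun v => Subgroup.subset_closure (Or.inr (by fin_cases v <;> simp))))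
    hna d ⟨s 0, s 1, by simpa [eqnCommD, map_pcomm, substHom] using hs⟩
    (by
      rw [← map_pcomm π, MonoidHom.comp_apply, ← map_mul π]
      exact hrel) (π T) hT1
  have hsol : ![a, b] ∈ algSet {eqnCommD (FreeGroup α) d} := by
    rintro w rfl
    simpa [eqnCommD, map_pcomm, substHom] using hab
  refine hsep (QuotientGroup.lift _ (substHom ![a, b])
    (Subgroup.normalClosure_le_normal (N := (substHom ![a, b]).ker) hsol)) ?_ ?_ ?_ (hT _ hsol)
  · intro g
    change substHom ![a, b] (Coprod.inl g) = g
    simp [substHom]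
  · change substHom ![a, b] (Coprod.inr (FreeGroup.of 0)) = a
    simp [substHom]
  · change substHom ![a, b] (Coprod.inr (FreeGroup.of 1)) = b
    simp [substHom]

lemma partII (α : Type) (hna : ∃ x y : FreeGroup α, ¬ Commute x y) :
    radical {eqnCommComm (FreeGroup α)} ≤ Subgroup.normalClosure {eqnCommComm (FreeGroup α)} := by
  intro T hT
  by_contra hTN
  let π := QuotientGroup.mk' (Subgroup.normalClosure {eqnCommComm (FreeGroup α)})
  have hπ : Function.Surjective π := QuotientGroup.mk'_surjective _
  have hT1 : π T ≠ 1 := by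
    intro h
    exact hTN ((QuotientGroup.eq_one_iff _).1 h)
  have hrel : π (eqnCommComm (FreeGroup α)) = 1 :=
    (QuotientGroup.eq_one_iff _).2 (Subgroup.subset_normalClosure rfl)
  obtain ⟨x2, hx2⟩ : ∃ x : Coprod (Coprod (FreeGroup α) (FreeGroup Unit)) (FreeGroup Unit),
    x = Coprod.inl (Coprod.inr (FreeGroup.of ())) := ⟨_, rfl⟩
  obtain ⟨y2, hy2⟩ : ∃ x : Coprod (Coprod (FreeGroup α) (FreeGroup Unit)) (FreeGroup Unit),
    x = Coprod.inr (FreeGroup.of ()) := ⟨_, rfl⟩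
  obtain ⟨i, hi⟩ : ∃ i : Coprod (Coprod (FreeGroup α) (FreeGroup Unit)) (FreeGroup Unit) →* _,
    i = Coprod.lift (Coprod.lift (π.comp Coprod.inl)
        (FreeGroup.lift fun _ => π (Coprod.inr (FreeGroup.of 2))))
      (FreeGroup.lift fun _ => π (Coprod.inr (FreeGroup.of 3))) := ⟨_, rfl⟩
  have hix : i x2 = π (Coprod.inr (FreeGroup.of 2)) := by simp [hi, hx2]
  have hiy : i y2 = π (Coprod.inr (FreeGroup.of 3)) := by simp [hi, hy2]
  have hig : ∀ g, i (Coprod.inl (Coprod.inl g)) = π (Coprod.inl g) := by intro g; simp [hi]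
  obtain ⟨a, b, hab, hsep⟩ := mainI i (π (Coprod.inr (FreeGroup.of 0)))
    (π (Coprod.inr (FreeGroup.of 1)))
    (closure_vars π hπ _ (fun g => Subgroup.subset_closure (Or.inl ⟨_, hig g⟩))
      (fun v => Subgroup.subset_closure (by
        fin_cases v
        · exact Or.inr (Or.inl rfl)
        · exact Or.inr (Or.inr rfl)
        · exact Or.inl ⟨_, hix⟩
        · exact Or.inl ⟨_, hiy⟩)))
    (nonabelian_coprod (nonabelian_coprod hna)) (pcomm x2 y2)
    ⟨y2, x2, by unfold pcomm; group⟩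
    (by
      rw [map_pcomm, hix, hiy]
      rw [← map_pcomm π, ← map_pcomm π, ← map_mul π]
      exact hrel) (π T) hT1
  obtain ⟨ψ, hψ⟩ : ∃ ψ : Coprod (FreeGroup α) (FreeGroup (Fin 4)) →*
      Coprod (Coprod (FreeGroup α) (FreeGroup Unit)) (FreeGroup Unit),
    ψ = Coprod.lift (Coprod.inl.comp Coprod.inl) (FreeGroup.lift ![a, b, x2, y2]) := ⟨_, rfl⟩
  have hψg : ∀ g, ψ (Coprod.inl g) = Coprod.inl (Coprod.inl g) := by intro g; simp [hψ]
  have hψ0 : ψ (Coprod.inr (FreeGroup.of 0)) = a := by simp [hψ]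
  have hψ1 : ψ (Coprod.inr (FreeGroup.of 1)) = b := by simp [hψ]
  have hψ2 : ψ (Coprod.inr (FreeGroup.of 2)) = x2 := by simp [hψ]
  have hψ3 : ψ (Coprod.inr (FreeGroup.of 3)) = y2 := by simp [hψ]
  have hψe : ψ (eqnCommComm (FreeGroup α)) = 1 := by
    rw [eqnCommComm, map_mul, map_pcomm, map_pcomm, hψ0, hψ1, hψ2, hψ3, hab]
  obtain ⟨φ, hφ⟩ : ∃ φ : (_ ⧸ (Subgroup.normalClosure {eqnCommComm (FreeGroup α)})) →* _,
      ∀ w, φ (π w) = ψ w :=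
    ⟨QuotientGroup.lift _ ψ (Subgroup.normalClosure_le_normal (N := ψ.ker) (by
      rintro w rfl; exact hψe)), fun w => rfl⟩
  have hφi : ∀ g, φ (i g) = g := by
    have : φ.comp i = MonoidHom.id _ := by
      apply Coprod.hom_ext
      · apply Coprod.hom_ext
        · apply MonoidHom.ext
          intro g
          change φ (i (Coprod.inl (Coprod.inl g))) = Coprod.inl (Coprod.inl g)
          rw [hig, hφ, hψg]
        · apply FreeGroup.ext_hom
          rintro ⟨⟩
          change φ (i (Coprod.inl (Coprod.inr (FreeGroup.of ())))) =
            Coprod.inl (Coprod.inr (FreeGroup.of ()))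
          rw [← hx2, hix, hφ, hψ2]
      · apply FreeGroup.ext_hom
        rintro ⟨⟩
        change φ (i (Coprod.inr (FreeGroup.of ()))) = Coprod.inr (FreeGroup.of ())
        rw [← hy2, hiy, hφ, hψ3]
    exact fun g => DFunLike.congr_fun this g
  have hψT : ψ T ≠ 1 := by
    rw [← hφ]
    exact hsep φ hφi (by rw [hφ, hψ0]) (by rw [hφ, hψ1])
  obtain ⟨g1, hg1, hg1T⟩ := sep_step (nonabelian_coprod hna) _ hψT
  obtain ⟨g0, hg0, hg0T⟩ := sep_step hna _ hg1T
  have hsub : substHom (fun v => g0 (g1 (ψ (Coprod.inr (FreeGroup.of v))))) =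
      (g0.comp g1).comp ψ := by
    apply Coprod.hom_ext
    · apply MonoidHom.ext
      intro g
      simp only [MonoidHom.comp_apply]
      rw [hψg, hg1, hg0]
      simp [substHom]
    · apply FreeGroup.ext_hom
      intro v
      simp [substHom]
  have := hT (fun v => g0 (g1 (ψ (Coprod.inr (FreeGroup.of v))))) (by
    rintro w rfl
    rw [hsub]
    change g0 (g1 (ψ _)) = 1
    rw [hψe, map_one, map_one])
  rw [hsub] at this
  exact hg0T this

/-- Over a non-abelian free group `F`:
(i) if the equation `[x,y]d = 1` has a solution in `F`, then its radical is the normal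
closure of `[x,y]d`; (ii) the radical of `[x₁,y₁][x₂,y₂] = 1` is the normal closure of
`[x₁,y₁][x₂,y₂]`. -/
theorem radical_of_commutator_equations
    (α : Type) (hna : ∃ x y : FreeGroup α, x * y ≠ y * x) :
    (∀ d : FreeGroup α, (algSet {eqnCommD (FreeGroup α) d}).Nonempty →
        radical {eqnCommD (FreeGroup α) d} =
          Subgroup.normalClosure {eqnCommD (FreeGroup α) d}) ∧
    radical {eqnCommComm (FreeGroup α)} =
      Subgroup.normalClosure {eqnCommComm (FreeGroup α)} := by
  have hna' : ∃ x y : FreeGroup α, ¬ Commute x y := hna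
  exact ⟨fun d hd => le_antisymm (partI α hna' d hd) (ncl_le_radical _),
    le_antisymm (partII α hna') (ncl_le_radical _)⟩
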